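/- Let e≥2, s∈ℤ^l, and let 𝛌, 𝛍 be l-partitions such that [𝛌]=[𝛍]∪{γ} for an addable node γ of 𝛍 of residue i∈ℤ/eℤ. Then p_{(e,s)}(𝛌) − p_{(e,s)}(𝛍) = M^s_i(𝛍) − 1. -/

import Mathlib

noncomputable section

/-- A partition: a nonincreasing sequence of nonnegative integers with finitely many
nonzero terms. `parts j` is the `(j+1)`-st part `λ_{j+1}` (0-indexed). -/
structure Ptn where
  parts : ℕ → ℕ
  antitone' : ∀ ⦃i j : ℕ⦄, i ≤ j → parts j ≤ parts i
  eventually_zero : ∃ N, ∀ n, N ≤ n → parts n = 0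

/-- The empty partition. -/
def Ptn.empty : Ptn := ⟨fun _ => 0, fun _ _ _ => le_rfl, ⟨0, fun _ _ => rfl⟩⟩

/-- The abacus `L_s(λ) = {λ_j − j + s : j ∈ ℤ_{>0}}` of a partition with charge `s`. -/
def abacus (s : ℤ) (lam : Ptn) : Set ℤ :=
  {x | ∃ j : ℕ, x = (lam.parts j : ℤ) - ((j : ℤ) + 1) + s}

/-- The Young diagram of an `l`-partition, with 0-indexed rows and columns:
`(a, b, c) ∈ diag 𝛌` represents the node in row `a+1`, column `b+1` of component `c`. -/
def diag {l : ℕ} (lam : Fin l → Ptn) : Set (ℕ × ℕ × Fin l) :=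
  {x | x.2.1 < (lam x.2.2).parts x.1}

/-- The rank of an `l`-partition: the number of nodes of its Young diagram. -/
def rank {l : ℕ} (lam : Fin l → Ptn) : ℕ := (diag lam).ncard

/-- The rank of a partition. -/
def rank₁ (lam : Ptn) : ℕ := rank (fun _ : Fin 1 => lam)

/-- The residue of the node `(a,b,c)` (0-indexed), i.e. `(b+1) − (a+1) + s_c mod e`. -/
def res (e : ℕ) {l : ℕ} (s : Fin l → ℤ) (x : ℕ × ℕ × Fin l) : ZMod e :=
  (((x.2.1 : ℤ) - (x.1 : ℤ) + s x.2.2 : ℤ) : ZMod e)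

/-- `c^{e,s}_i(𝛌)`: the number of nodes of `𝛌` of residue `i`. -/
def resCount (e : ℕ) {l : ℕ} (s : Fin l → ℤ) (lam : Fin l → Ptn) (i : ZMod e) : ℕ :=
  {x ∈ diag lam | res e s x = i}.ncard

/-- `c^{e,(t)}_i(λ)` for a single partition with charge `t`. -/
def resCount₁ (e : ℕ) (t : ℤ) (lam : Ptn) (i : ZMod e) : ℕ :=
  resCount e (fun _ : Fin 1 => t) (fun _ => lam) i

/-- A node `γ` of `𝛌` is removable if deleting it yields the Young diagram
of an `l`-partition. -/
def Removable {l : ℕ} (lam : Fin l → Ptn) (γ : ℕ × ℕ × Fin l) : Prop :=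
  γ ∈ diag lam ∧ ∃ mu : Fin l → Ptn, diag mu = diag lam \ {γ}

/-- A node `γ ∉ [𝛌]` is addable for `𝛌` if adding it yields the Young diagram
of an `l`-partition. -/
def Addable {l : ℕ} (lam : Fin l → Ptn) (γ : ℕ × ℕ × Fin l) : Prop :=
  γ ∉ diag lam ∧ ∃ mu : Fin l → Ptn, diag mu = diag lam ∪ {γ}

/-- `M^s_i(𝛌)`: the number of addable nodes of residue `i` minus the number of
removable nodes of residue `i`. -/
def Mnum (e : ℕ) {l : ℕ} (s : Fin l → ℤ) (lam : Fin l → Ptn) (i : ZMod e) : ℤ :=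
  ({γ | Addable lam γ ∧ res e s γ = i}.ncard : ℤ) -
    ({γ | Removable lam γ ∧ res e s γ = i}.ncard : ℤ)

/-- `M^{(t)}_i(λ)` for a single partition with charge `t`. -/
def Mnum₁ (e : ℕ) (t : ℤ) (lam : Ptn) (i : ZMod e) : ℤ :=
  Mnum e (fun _ : Fin 1 => t) (fun _ => lam) i

/-- The block `(e,s)`-weight of Fayers:
`p_{(e,s)}(𝛌) = Σ_{i=1}^{l} c_{s_i}(𝛌) − (1/2) Σ_{i ∈ ℤ/eℤ} (c_i(𝛌) − c_{i−1}(𝛌))²`. -/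
def blockWeight (e : ℕ) {l : ℕ} (s : Fin l → ℤ) (lam : Fin l → Ptn) : ℚ :=
  (∑ i : Fin l, (resCount e s lam ((s i : ZMod e)) : ℚ)) -
    (1 / 2) * ∑ i ∈ Finset.range e,
      ((resCount e s lam ((i : ZMod e)) : ℚ) - (resCount e s lam ((i : ZMod e) - 1) : ℚ)) ^ 2

/-- Block weight of a single partition with charge `t`. -/
def blockWeight₁ (e : ℕ) (t : ℤ) (lam : Ptn) : ℚ :=
  blockWeight e (fun _ : Fin 1 => t) (fun _ => lam)

/-- The `l`-abacus `(L_{s_1}(λ^1),…,L_{s_l}(λ^l))` is `(e,s)`-complete: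
`L_{s_1}(λ^1) ⊆ … ⊆ L_{s_l}(λ^l) ⊆ {x+e : x ∈ L_{s_1}(λ^1)}`. -/
def Complete (e : ℕ) {l : ℕ} (s : Fin l → ℤ) (lam : Fin l → Ptn) : Prop :=
  (∀ i j : Fin l, (j : ℕ) = (i : ℕ) + 1 →
      abacus (s i) (lam i) ⊆ abacus (s j) (lam j)) ∧
  (∀ i j : Fin l, (i : ℕ) = l - 1 → (j : ℕ) = 0 →
      abacus (s i) (lam i) ⊆ {x | x - (e : ℤ) ∈ abacus (s j) (lam j)})

/-- `𝒜̄^l_e = {s ∈ ℤ^l : 0 ≤ s_j − s_i ≤ e for all i < j}`. -/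
def Abar (e : ℕ) {l : ℕ} (s : Fin l → ℤ) : Prop :=
  ∀ i j : Fin l, i < j → 0 ≤ s j - s i ∧ s j - s i ≤ (e : ℤ)

/-- `𝒜^l_e = {s ∈ ℤ^l : 0 ≤ s_j − s_i < e for all i < j}`. -/
def Aset (e : ℕ) {l : ℕ} (s : Fin l → ℤ) : Prop :=
  ∀ i j : Fin l, i < j → 0 ≤ s j - s i ∧ s j - s i < (e : ℤ)

/-- A partition is an `e`-core if its abacus is stable under subtracting `e`
(a condition independent of the charge). -/
def IsECore (e : ℕ) (lam : Ptn) : Prop :=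
  ∀ x ∈ abacus 0 lam, x - (e : ℤ) ∈ abacus 0 lam

/-- The permutation `σ_s`: the unique permutation sorting the residues
`s'_i = s_i mod e ∈ {0,…,e−1}` increasingly and stably. -/
def sigmaPerm (e : ℕ) {l : ℕ} (s : Fin l → ℤ) : Equiv.Perm (Fin l) :=
  Tuple.sort (fun i => s i % (e : ℤ))

/-- `𝛌` is an `(e,s)`-core if `𝛌^{σ_s}` is a reduced `(e, s̃^{σ_s})`-core. -/
def IsCore (e : ℕ) {l : ℕ} (s : Fin l → ℤ) (lam : Fin l → Ptn) : Prop :=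
  Complete e (fun i => s (sigmaPerm e s i) % (e : ℤ)) (fun i => lam (sigmaPerm e s i))

/-- The set `{(l−c)e + q·e·l + r : 1 ≤ c ≤ l, q ∈ ℤ, 0 ≤ r ≤ e−1, qe+r ∈ L_{s_c}(λ^c)}`
(with `c = (c' : Fin l) + 1`). -/
def uglovSet (e : ℕ) {l : ℕ} (s : Fin l → ℤ) (lam : Fin l → Ptn) : Set ℤ :=
  {y | ∃ (c : Fin l) (q : ℤ) (r : ℕ), r < e ∧
      (q * (e : ℤ) + (r : ℤ)) ∈ abacus (s c) (lam c) ∧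
      y = ((l : ℤ) - 1 - ((c : ℕ) : ℤ)) * (e : ℤ) + q * (e : ℤ) * (l : ℤ) + (r : ℤ)}

/-- `μ = τ_{e,s}(𝛌)`: the Uglov map sends `𝛌` to the unique partition `μ` whose abacus
with charge `t = s_1 + … + s_l` is the Uglov set of `(𝛌,s)`. -/
def IsUglov (e : ℕ) {l : ℕ} (s : Fin l → ℤ) (lam : Fin l → Ptn) (mu : Ptn) : Prop :=
  abacus (∑ i, s i) mu = uglovSet e s lam

/-- An elementary operation on a pair (`l`-partition, multicharge), performed on the
associated `l`-abacus. -/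
def ElemOp (e : ℕ) {l : ℕ} (p q : (Fin l → Ptn) × (Fin l → ℤ)) : Prop :=
  (∃ (i j : Fin l) (x : ℤ), (j : ℕ) = (i : ℕ) + 1 ∧
      x ∈ abacus (p.2 i) (p.1 i) ∧ x ∉ abacus (p.2 j) (p.1 j) ∧
      abacus (q.2 i) (q.1 i) = abacus (p.2 i) (p.1 i) \ {x} ∧
      abacus (q.2 j) (q.1 j) = abacus (p.2 j) (p.1 j) ∪ {x} ∧
      q.2 i = p.2 i - 1 ∧ q.2 j = p.2 j + 1 ∧
      (∀ k, k ≠ i → k ≠ j → q.1 k = p.1 k ∧ q.2 k = p.2 k)) ∨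
  (∃ (i j : Fin l) (x : ℤ), (i : ℕ) = l - 1 ∧ (j : ℕ) = 0 ∧
      x ∈ abacus (p.2 i) (p.1 i) ∧ x - (e : ℤ) ∉ abacus (p.2 j) (p.1 j) ∧
      (i = j → abacus (q.2 i) (q.1 i) = (abacus (p.2 i) (p.1 i) \ {x}) ∪ {x - (e : ℤ)} ∧
        q.2 i = p.2 i) ∧
      (i ≠ j → abacus (q.2 i) (q.1 i) = abacus (p.2 i) (p.1 i) \ {x} ∧
        abacus (q.2 j) (q.1 j) = abacus (p.2 j) (p.1 j) ∪ {x - (e : ℤ)} ∧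
        q.2 i = p.2 i - 1 ∧ q.2 j = p.2 j + 1) ∧
      (∀ k, k ≠ i → k ≠ j → q.1 k = p.1 k ∧ q.2 k = p.2 k))

/-- A sequence of `n` elementary operations starting from `p`. -/
def OpSeq (e : ℕ) {l : ℕ} (p : (Fin l → Ptn) × (Fin l → ℤ))
    (f : ℕ → (Fin l → Ptn) × (Fin l → ℤ)) (n : ℕ) : Prop :=
  f 0 = p ∧ ∀ k < n, ElemOp e (f k) (f (k + 1))

/-- A maximal sequence of elementary operations: performed until the resulting
`l`-abacus is complete for the current multicharge. -/
def MaxOpSeq (e : ℕ) {l : ℕ} (p : (Fin l → Ptn) × (Fin l → ℤ))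
    (f : ℕ → (Fin l → Ptn) × (Fin l → ℤ)) (n : ℕ) : Prop :=
  OpSeq e p f n ∧ Complete e (f n).2 (f n).1

/-- `q` is the core of the pair `p`: it is reached from `p` by a maximal sequence
of elementary operations. -/
def IsCorePairOf (e : ℕ) {l : ℕ} (p q : (Fin l → Ptn) × (Fin l → ℤ)) : Prop :=
  ∃ f n, MaxOpSeq e p f n ∧ f n = q

/-- `κ = Core_e(λ)`: on abaci, the abacus of `κ` is obtained from that of `λ` by
repeatedly replacing an element `y` with `y − e ∉ L` by `y − e`, until no such
replacement is possible. -/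
def IsECoreOf (e : ℕ) (kappa lam : Ptn) : Prop :=
  IsECore e kappa ∧ ∃ (f : ℕ → Ptn) (m : ℕ), f 0 = lam ∧ f m = kappa ∧
    ∀ k < m, ∃ y ∈ abacus 0 (f k), y - (e : ℤ) ∉ abacus 0 (f k) ∧
      abacus 0 (f (k + 1)) = (abacus 0 (f k) \ {y}) ∪ {y - (e : ℤ)}

end

open Classical in
theorem addable_iff {l : ℕ} (lam : Fin l → Ptn) (a b : ℕ) (c : Fin l) :
    Addable lam (a, b, c) ↔
      b = (lam c).parts a ∧ (a = 0 ∨ (lam c).parts a < (lam c).parts (a - 1)) := by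
  constructor
  · rintro ⟨h1, nu, h2⟩
    have key : ∀ a' b', b' < (nu c).parts a' ↔ (b' < (lam c).parts a' ∨ (a' = a ∧ b' = b)) := by
      intro a' b'
      have := Set.ext_iff.1 h2 (a', b', c)
      simpa [diag, or_comm] using this
    have h1' : (lam c).parts a ≤ b := by simpa [diag] using h1
    have hb : b < (nu c).parts a := (key a b).2 (Or.inr ⟨rfl, rfl⟩)
    have h3 := (key a ((lam c).parts a)).1 (by omega)
    have hbe : b = (lam c).parts a := by omega
    refine ⟨hbe, ?_⟩
    by_cases ha : a = 0
    · exact Or.inl ha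
    · right
      have h4 := (nu c).antitone' (Nat.sub_le a 1)
      have h5 := (key (a - 1) b).1 (by omega)
      omega
  · rintro ⟨rfl, h⟩
    refine ⟨by simp [diag], ?_⟩
    refine ⟨Function.update lam c
      ⟨fun n => if n = a then (lam c).parts a + 1 else (lam c).parts n, ?_, ?_⟩, ?_⟩
    · intro i j hij
      have h1 := (lam c).antitone' hij
      split_ifs with h2 h3 h3
      · omega
      · subst h2
        have := (lam c).antitone' (show i ≤ j - 1 by omega)
        omega
      · subst h3; omega
      · exact h1
    · obtain ⟨N, hN⟩ := (lam c).eventually_zero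
      refine ⟨N + a + 1, fun n hn => ?_⟩
      rw [if_neg (by omega)]
      exact hN n (by omega)
    · ext ⟨a', b', c'⟩
      by_cases hc : c' = c
      · subst hc
        by_cases ha : a' = a
        · subst ha
          simp [diag]; omega
        · simp [diag, ha]
      · simp [diag, hc]

open Classical in
theorem removable_iff {l : ℕ} (lam : Fin l → Ptn) (a b : ℕ) (c : Fin l) :
    Removable lam (a, b, c) ↔
      b + 1 = (lam c).parts a ∧ (lam c).parts (a + 1) < (lam c).parts a := by
  constructor
  · rintro ⟨h1, nu, h2⟩
    have key : ∀ a' b', b' < (nu c).parts a' ↔ (b' < (lam c).parts a' ∧ ¬ (a' = a ∧ b' = b)) := by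
      intro a' b'
      have := Set.ext_iff.1 h2 (a', b', c)
      simpa [diag] using this
    have h1' : b < (lam c).parts a := by simpa [diag] using h1
    have hb := key a b
    have hb1 := key a (b + 1)
    have h5 := key (a + 1) b
    have h4 := (nu c).antitone' (Nat.le_succ a)
    simp only [Nat.succ_eq_add_one] at h4
    constructor <;> omega
  · rintro ⟨hb, h⟩
    refine ⟨by simp [diag]; omega, ?_⟩
    refine ⟨Function.update lam c
      ⟨fun n => if n = a then b else (lam c).parts n, ?_, ?_⟩, ?_⟩
    · intro i j hij
      have h1 := (lam c).antitone' hij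
      split_ifs with h2 h3 h3
      · omega
      · subst h2; omega
      · subst h3
        have := (lam c).antitone' (show i + 1 ≤ j by omega)
        omega
      · exact h1
    · obtain ⟨N, hN⟩ := (lam c).eventually_zero
      refine ⟨N + a + 1, fun n hn => ?_⟩
      rw [if_neg (by omega)]
      exact hN n (by omega)
    · ext ⟨a', b', c'⟩
      by_cases hc : c' = c
      · subst hc
        by_cases ha : a' = a
        · subst ha
          simp [diag]; omega
        · simp [diag, ha]
      · simp [diag, hc]

theorem exists_bound {l : ℕ} (lam : Fin l → Ptn) :
    ∃ N, (∀ c, ∀ n, N ≤ n → (lam c).parts n = 0) ∧ ∀ c n, (lam c).parts n ≤ N := by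
  choose f hf using fun c => (lam c).eventually_zero
  refine ⟨∑ c, f c + ∑ c, (lam c).parts 0, fun c n hn => hf c n ?_, fun c n => ?_⟩
  · have := Finset.single_le_sum (f := f) (fun _ _ => Nat.zero_le _) (Finset.mem_univ c)
    omega
  · have := Finset.single_le_sum (f := fun c => (lam c).parts 0) (fun _ _ => Nat.zero_le _)
      (Finset.mem_univ c)
    have h2 := (lam c).antitone' (Nat.zero_le n)
    omega

open Classical in
theorem ncard_box {l : ℕ} (P : ℕ × ℕ × Fin l → Prop) (N : ℕ)
    (h : ∀ a b c, P (a, b, c) → a < N ∧ b < N) :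
    ({x | P x}.ncard : ℤ) =
      ∑ c : Fin l, ∑ a ∈ Finset.range N, ∑ b ∈ Finset.range N, if P (a, b, c) then 1 else 0 := by
  have : {x | P x} = ↑((Finset.range N ×ˢ Finset.range N ×ˢ
      (Finset.univ : Finset (Fin l))).filter P) := by
    ext ⟨a, b, c⟩
    simp only [Set.mem_ofPred_eq, Finset.coe_filter, Finset.mem_product, Finset.mem_range,
      Finset.mem_univ, and_true]
    exact ⟨fun hp => ⟨h a b c hp, hp⟩, fun hp => hp.2⟩
  rw [this, Set.ncard_coe_finset, Finset.card_filter, Finset.sum_product]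
  push_cast
  simp_rw [Finset.sum_product]
  have h1 : ∀ a ∈ Finset.range N, (∑ b ∈ Finset.range N, ∑ c : Fin l,
      (if P (a, b, c) then (1 : ℤ) else 0)) =
      ∑ c : Fin l, ∑ b ∈ Finset.range N, (if P (a, b, c) then (1 : ℤ) else 0) :=
    fun a _ => Finset.sum_comm
  rw [Finset.sum_congr rfl h1, Finset.sum_comm]

open Classical in
theorem resCount_sum (e : ℕ) {l : ℕ} (s : Fin l → ℤ) (lam : Fin l → Ptn) (N : ℕ)
    (h0 : ∀ c, ∀ n, N ≤ n → (lam c).parts n = 0) (hN : ∀ c n, (lam c).parts n ≤ N)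
    (i : ZMod e) :
    (resCount e s lam i : ℤ) = ∑ c : Fin l, ∑ a ∈ Finset.range N,
      ∑ b ∈ Finset.range ((lam c).parts a),
        if ((b : ZMod e) - a + s c) = i then 1 else 0 := by
  unfold resCount
  rw [ncard_box (fun x => x ∈ diag lam ∧ res e s x = i) N]
  · refine Finset.sum_congr rfl fun c _ => Finset.sum_congr rfl fun a _ => ?_
    have : Finset.range ((lam c).parts a) =
        (Finset.range N).filter (fun b => b < (lam c).parts a) := by
      ext b; have := hN c a; simp; omega
    rw [this, Finset.sum_filter]
    refine Finset.sum_congr rfl fun b _ => ?_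
    simp [diag, res, ite_and]
  · rintro a b c ⟨h, -⟩
    simp only [diag, Set.mem_ofPred_eq] at h
    have h1 := hN c a
    have h2 := h0 c a
    omega

open Classical in
theorem addable_sum (e : ℕ) {l : ℕ} (s : Fin l → ℤ) (lam : Fin l → Ptn) (N : ℕ)
    (h0 : ∀ c, ∀ n, N ≤ n → (lam c).parts n = 0) (hN : ∀ c n, (lam c).parts n ≤ N)
    (i : ZMod e) :
    ({γ | Addable lam γ ∧ res e s γ = i}.ncard : ℤ) = ∑ c : Fin l, ∑ a ∈ Finset.range (N + 1),
      if (a = 0 ∨ (lam c).parts a < (lam c).parts (a - 1)) then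
        (if (((lam c).parts a : ZMod e) - a + s c) = i then 1 else 0) else 0 := by
  rw [ncard_box (fun γ => Addable lam γ ∧ res e s γ = i) (N + 1)]
  · refine Finset.sum_congr rfl fun c _ => Finset.sum_congr rfl fun a _ => ?_
    rw [Finset.sum_eq_single ((lam c).parts a)]
    · simp [addable_iff, res, ite_and]
    · intro b _ hb
      simp [addable_iff, hb]
    · intro hb
      have := hN c a
      simp at hb; omega
  · rintro a b c ⟨h, -⟩
    rw [addable_iff] at h
    have h1 := hN c a
    have h2 := h0 c (a - 1)
    omega

open Classical in
theorem removable_sum (e : ℕ) {l : ℕ} (s : Fin l → ℤ) (lam : Fin l → Ptn) (N : ℕ)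
    (h0 : ∀ c, ∀ n, N ≤ n → (lam c).parts n = 0) (hN : ∀ c n, (lam c).parts n ≤ N)
    (i : ZMod e) :
    ({γ | Removable lam γ ∧ res e s γ = i}.ncard : ℤ) = ∑ c : Fin l, ∑ a ∈ Finset.range N,
      if (lam c).parts (a + 1) < (lam c).parts a then
        (if (((lam c).parts a : ZMod e) - 1 - a + s c) = i then 1 else 0) else 0 := by
  rw [ncard_box (fun γ => Removable lam γ ∧ res e s γ = i) N]
  · refine Finset.sum_congr rfl fun c _ => Finset.sum_congr rfl fun a _ => ?_
    by_cases hlt : (lam c).parts (a + 1) < (lam c).parts a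
    · obtain ⟨k, hk⟩ : ∃ k, (lam c).parts a = k + 1 := ⟨(lam c).parts a - 1, by omega⟩
      rw [Finset.sum_eq_single k]
      · simp only [removable_iff, res, hlt, hk]
        rw [hk] at hlt
        simp [hlt]
      · intro b _ hb
        have : ¬ (b + 1 = (lam c).parts a) := by omega
        simp [removable_iff, this]
      · intro hb
        have := hN c a
        simp at hb; omega
    · simp [removable_iff, hlt]
  · rintro a b c ⟨h, -⟩
    rw [removable_iff] at h
    have h1 := hN c a
    have h2 := h0 c a
    omega

/-- one component telescoping -/
theorem comp_identity {e : ℕ} (f : ZMod e → ℤ) (t : ZMod e) (p : ℕ → ℕ)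
    (hp : ∀ a, p (a + 1) ≤ p a) (N : ℕ) (hN : p N = 0) :
    (∑ a ∈ Finset.range (N + 1),
      (if (a = 0 ∨ p a < p (a - 1)) then f ((p a : ZMod e) - a + t) else 0)) -
    (∑ a ∈ Finset.range N, (if p (a + 1) < p a then f ((p a : ZMod e) - 1 - a + t) else 0)) =
    f t + ∑ a ∈ Finset.range N, ∑ b ∈ Finset.range (p a),
      (f ((b : ZMod e) - a + t + 1) - 2 * f ((b : ZMod e) - a + t) + f ((b : ZMod e) - a + t - 1))
       := by
  have row : ∀ (x : ZMod e) (n : ℕ), ∑ b ∈ Finset.range n,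
      (f ((b : ZMod e) + x + 1) - 2 * f ((b : ZMod e) + x) + f ((b : ZMod e) + x - 1)) =
      f (n + x) - f (n + x - 1) - f x + f (x - 1) := by
    intro x n
    induction n with
    | zero => simp
    | succ n ih =>
      rw [Finset.sum_range_succ, ih]
      push_cast
      have h1 : (n : ZMod e) + 1 + x = n + x + 1 := by ring
      rw [h1, add_sub_cancel_right]
      ring
  have row' : ∀ a : ℕ, ∑ b ∈ Finset.range (p a),
      (f ((b : ZMod e) - a + t + 1) - 2 * f ((b : ZMod e) - a + t)
        + f ((b : ZMod e) - a + t - 1)) =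
      f (p a - a + t) - f (p a - 1 - a + t) - f (t - a) + f (t - (a + 1 : ℕ)) := by
    intro a
    have := row (t - a) (p a)
    have h1 : (p a : ZMod e) + (t - a) = p a - a + t := by ring
    have h2 : (p a : ZMod e) - a + t - 1 = p a - 1 - a + t := by ring
    have h3 : t - (a : ZMod e) - 1 = t - (a + 1 : ℕ) := by push_cast; ring
    rw [h1, h2, h3] at this
    rw [← this]
    refine Finset.sum_congr rfl fun b _ => ?_
    have h4 : (b : ZMod e) + (t - a) = b - a + t := by ring
    rw [h4]
  simp_rw [row']
  have main : ∀ N, (∑ a ∈ Finset.range (N + 1),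
      (if (a = 0 ∨ p a < p (a - 1)) then f ((p a : ZMod e) - a + t) else 0)) -
    (∑ a ∈ Finset.range N, (if p (a + 1) < p a then f ((p a : ZMod e) - 1 - a + t) else 0)) =
    f t + ∑ a ∈ Finset.range N, (f (p a - a + t) - f (p a - 1 - a + t) - f (t - a)
      + f (t - (a + 1 : ℕ))) + f (p N - N + t) - f (t - N) := by
    intro N
    induction N with
    | zero => simp
    | succ N ih =>
      rw [Finset.sum_range_succ _ (N + 1), Finset.sum_range_succ (fun a => if p (a + 1) < p a then _ else _) N,
        Finset.sum_range_succ (fun a => f _ - _ - _ + _) N]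
      by_cases h : p (N + 1) < p N
      · simp only [h, Nat.add_sub_cancel, or_true, if_true]
        linarith
      · have h' : p (N + 1) = p N := le_antisymm (hp N) (not_lt.1 h)
        simp only [Nat.add_sub_cancel, or_false, if_false, Nat.succ_ne_zero, h', lt_irrefl]
        have h5 : (p N : ZMod e) - (N + 1 : ℕ) + t = p N - 1 - N + t := by push_cast; ring
        rw [h5]
        linarith
  rw [main N, hN]
  have : ((0 : ℕ) : ZMod e) - N + t = t - N := by push_cast; ring
  rw [this]; ring

open Classical in
theorem Mnum_formula (e : ℕ) {l : ℕ} (s : Fin l → ℤ) (lam : Fin l → Ptn) (i : ZMod e) :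
    Mnum e s lam i = (∑ c : Fin l, if (s c : ZMod e) = i then 1 else 0) +
      resCount e s lam (i - 1) - 2 * resCount e s lam i + resCount e s lam (i + 1) := by
  obtain ⟨N, h0, hN⟩ := exists_bound lam
  unfold Mnum
  rw [addable_sum e s lam N h0 hN, removable_sum e s lam N h0 hN,
    resCount_sum e s lam N h0 hN, resCount_sum e s lam N h0 hN, resCount_sum e s lam N h0 hN,
    ← Finset.sum_sub_distrib, Finset.mul_sum, ← Finset.sum_add_distrib,
    ← Finset.sum_sub_distrib, ← Finset.sum_add_distrib]
  refine Finset.sum_congr rfl fun c _ => ?_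
  have := comp_identity (fun x : ZMod e => if x = i then (1 : ℤ) else 0) (s c) (lam c).parts
    (fun a => (lam c).antitone' (Nat.le_succ a)) N (h0 c N le_rfl)
  rw [this]
  simp only [Finset.sum_add_distrib, Finset.sum_sub_distrib, ← Finset.mul_sum]
  simp only [eq_sub_iff_add_eq, sub_eq_iff_eq_add]
  ring

theorem sum_range_zmod (e : ℕ) [NeZero e] (F : ZMod e → ℚ) :
    ∑ j ∈ Finset.range e, F (j : ZMod e) = ∑ j : ZMod e, F j := by
  refine Finset.sum_nbij' (fun j => (j : ZMod e)) (fun j => j.val) ?_ ?_ ?_ ?_ ?_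
  · simp
  · intro j _; simpa using ZMod.val_lt j
  · intro j hj; exact ZMod.val_cast_of_lt (Finset.mem_range.1 hj)
  · intro j _; simp
  · simp

theorem diag_finite {l : ℕ} (lam : Fin l → Ptn) : (diag lam).Finite := by
  obtain ⟨N, h0, hN⟩ := exists_bound lam
  refine Set.Finite.subset (Finset.finite_toSet (Finset.range N ×ˢ Finset.range N ×ˢ
      (Finset.univ : Finset (Fin l)))) ?_
  rintro ⟨a, b, c⟩ h
  simp only [diag, Set.mem_ofPred_eq] at h
  have h1 := hN c a
  have h2 := h0 c a
  simp
  omega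

open Classical in
theorem resCount_add (e : ℕ) {l : ℕ} (s : Fin l → ℤ) (lam mu : Fin l → Ptn)
    (γ : ℕ × ℕ × Fin l) (hγ : γ ∉ diag mu) (hdiag : diag lam = diag mu ∪ {γ}) (j : ZMod e) :
    (resCount e s lam j : ℚ) = resCount e s mu j + if j = res e s γ then 1 else 0 := by
  unfold resCount
  rw [hdiag]
  split_ifs with h
  · have : {x | x ∈ diag mu ∪ {γ} ∧ res e s x = j} =
        insert γ {x | x ∈ diag mu ∧ res e s x = j} := by
      ext x
      simp only [Set.mem_union, Set.mem_singleton_iff, Set.mem_ofPred_eq, Set.mem_insert_iff]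
      constructor
      · tauto
      · rintro (rfl | h')
        · exact ⟨Or.inr rfl, h.symm⟩
        · tauto
    rw [this, Set.ncard_insert_of_notMem (fun h' => hγ h'.1)
      ((diag_finite mu).subset fun x hx => hx.1)]
    push_cast; rfl
  · have : {x | x ∈ diag mu ∪ {γ} ∧ res e s x = j} = {x | x ∈ diag mu ∧ res e s x = j} := by
      ext x
      simp only [Set.mem_union, Set.mem_singleton_iff, Set.mem_ofPred_eq]
      constructor
      · rintro ⟨h1 | rfl, h2⟩
        · exact ⟨h1, h2⟩
        · exact absurd h2.symm h
      · tauto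
    rw [this, add_zero]

/-- if `𝛌` is obtained from `𝛍` by adding an addable node of
residue `i`, then `p_{(e,s)}(𝛌) − p_{(e,s)}(𝛍) = M^s_i(𝛍) − 1`. -/
theorem stmt12 (e l : ℕ) (he : 2 ≤ e) (hl : 1 ≤ l) (s : Fin l → ℤ)
    (lam mu : Fin l → Ptn) (γ : ℕ × ℕ × Fin l) (i : ZMod e)
    (hγ : Addable mu γ) (hres : res e s γ = i)
    (hdiag : diag lam = diag mu ∪ {γ}) :
    blockWeight e s lam - blockWeight e s mu = (Mnum e s mu i : ℚ) - 1 := by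
  classical
  haveI : NeZero e := ⟨by omega⟩
  haveI : Fact (1 < e) := ⟨by omega⟩
  have hc := resCount_add e s lam mu γ hγ.1 hdiag
  rw [hres] at hc
  rw [Mnum_formula]
  unfold blockWeight
  simp only [hc]
  set C : ZMod e → ℚ := fun j => (resCount e s mu j : ℚ) with hC
  have hC' : ∀ j, (resCount e s mu j : ℚ) = C j := fun _ => rfl
  push_cast
  simp only [hC']
  rw [sum_range_zmod e (fun j => (C j + (if j = i then 1 else 0) -
      (C (j - 1) + if j - 1 = i then 1 else 0)) ^ 2),
    sum_range_zmod e (fun j => (C j - C (j - 1)) ^ 2)]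
  have key : ∀ j : ZMod e, (C j + (if j = i then 1 else 0) -
      (C (j - 1) + if j - 1 = i then 1 else 0)) ^ 2 = (C j - C (j - 1)) ^ 2 +
      (if j = i then 2 * (C j - C (j - 1)) + 1 else 0) +
      (if j = i + 1 then -2 * (C j - C (j - 1)) + 1 else 0) := by
    intro j
    simp only [sub_eq_iff_eq_add]
    by_cases h1 : j = i
    · have h2 : ¬ (j = i + 1) := by rw [h1]; simp
      simp only [h1, if_true]
      rw [h1] at h2
      simp only [h2, if_false]
      ring
    · by_cases h2 : j = i + 1
      · simp only [h1, h2, if_true, if_false]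
        rw [h2] at h1
        simp only [h1, if_false]
        ring
      · simp only [h1, h2, if_false]
        ring
  simp only [key, Finset.sum_add_distrib, Finset.sum_ite_eq', Finset.mem_univ, if_true]
  rw [add_sub_cancel_right]
  ring
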